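/- For any two dyadic intervals [s,t] and [s',t'] in ℝ/ℤ there exist integers n, m ≥ 0 and a homeomorphism g from the open arc (s,t) onto the open arc (s',t') such that σ₂^n ∘ g = σ₂^m on (s,t). -/

import Mathlib

noncomputable section

open Set

/-- The circle `ℝ/ℤ`. -/
abbrev 𝕊 : Type := AddCircle (1 : ℝ)

/-- The natural projection from `ℝ` to the circle `ℝ/ℤ`. -/
def tc (x : ℝ) : 𝕊 := (x : 𝕊)

/-- The closed arc on the circle from `a` to `b`, traversed in the positive direction;
arcs are parametrized by real lifts `a ≤ b ≤ a + 1` of their endpoints. -/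
def cArc (a b : ℝ) : Set 𝕊 := tc '' Set.Icc a b

/-- The open arc on the circle from `a` to `b` (the interior of `cArc a b`). -/
def oArc (a b : ℝ) : Set 𝕊 := tc '' Set.Ioo a b

/-- The multiplication-by-`d` map `σ_d : ℝ/ℤ → ℝ/ℤ`, `σ_d t = d·t`. -/
def sigmaC (d : ℕ) (x : 𝕊) : 𝕊 := d • x

/-- A real number is a dyadic rational. -/
def IsDyadicR (x : ℝ) : Prop := ∃ (p : ℤ) (n : ℕ), x = p / 2 ^ n

/-- The exponent of the reduced-form denominator of a dyadic rational. -/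
def dyadicLevel (x : ℝ) : ℕ := sInf {n : ℕ | ∃ p : ℤ, x = p / 2 ^ n}

/-- The reduced-form denominator of a dyadic rational. -/
def dyadicDenom (x : ℝ) : ℕ := 2 ^ dyadicLevel x

/-- The arc `[a,b]` of the circle `ℝ/ℤ` is a dyadic interval: its endpoints are dyadic
rationals, and every dyadic rational in the open arc `(a,b)` has reduced-form denominator
strictly greater than the reduced-form denominators of both endpoints. -/
structure IsDyadicInterval (a b : ℝ) : Prop where
  lt : a < b
  le : b ≤ a + 1
  dyA : IsDyadicR a
  dyB : IsDyadicR b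
  denom : ∀ x ∈ Set.Ioo a b, IsDyadicR x →
    dyadicDenom a < dyadicDenom x ∧ dyadicDenom b < dyadicDenom x

theorem IsDyadicR.exists_eq_div_dyadicLevel {x : ℝ} (hx : IsDyadicR x) :
    ∃ p : ℤ, x = p / 2 ^ dyadicLevel x := by
  obtain ⟨p, n, hp⟩ := hx
  exact Nat.sInf_mem (s := {n : ℕ | ∃ p : ℤ, x = p / 2 ^ n}) ⟨n, p, hp⟩

theorem IsDyadicR.exists_eq_div_of_le {x : ℝ} (hx : IsDyadicR x) {k : ℕ}
    (hk : dyadicLevel x ≤ k) : ∃ p : ℤ, x = p / 2 ^ k := by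
  obtain ⟨p, hp⟩ := hx.exists_eq_div_dyadicLevel
  obtain ⟨j, rfl⟩ := Nat.exists_eq_add_of_le hk
  refine ⟨p * 2 ^ j, ?_⟩
  push_cast
  rw [pow_add, mul_div_mul_right _ _ (by positivity), ← hp]

theorem dyadicLevel_div_le (p : ℤ) (k : ℕ) : dyadicLevel ((p : ℝ) / 2 ^ k) ≤ k :=
  Nat.sInf_le ⟨p, rfl⟩

/-- The endpoints of a dyadic interval are consecutive multiples of some `1 / 2 ^ k`. -/
theorem IsDyadicInterval.exists_consecutive {a b : ℝ} (h : IsDyadicInterval a b) :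
    ∃ (k : ℕ) (p : ℤ), a = p / 2 ^ k ∧ b = (p + 1) / 2 ^ k := by
  obtain ⟨k, hk⟩ : ∃ k, k = max (dyadicLevel a) (dyadicLevel b) := ⟨_, rfl⟩
  obtain ⟨p, hp⟩ := h.dyA.exists_eq_div_of_le (hk ▸ le_max_left _ _)
  obtain ⟨q, hq⟩ := h.dyB.exists_eq_div_of_le (hk ▸ le_max_right _ _)
  have h2 : (0 : ℝ) < 2 ^ k := by positivity
  have hpq : p < q := by
    have := h.lt
    rw [hp, hq, div_lt_div_iff_of_pos_right h2] at this
    exact_mod_cast this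
  obtain hlt | heq := (Int.add_one_le_of_lt hpq).lt_or_eq
  · exfalso
    have hmem : ((p + 1 : ℤ) : ℝ) / 2 ^ k ∈ Ioo a b := by
      rw [hp, hq]
      constructor <;> rw [div_lt_div_iff_of_pos_right h2]
      · exact_mod_cast Int.lt_succ p
      · exact_mod_cast hlt
    obtain ⟨ha, hb⟩ := h.denom _ hmem ⟨p + 1, k, rfl⟩
    have ha' := (Nat.pow_lt_pow_iff_right one_lt_two).1 ha
    have hb' := (Nat.pow_lt_pow_iff_right one_lt_two).1 hb
    exact (dyadicLevel_div_le (p + 1) k).not_gt (hk.trans_lt (max_lt ha' hb'))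
  · exact ⟨k, p, hp, by rw [hq, ← heq]; push_cast; rfl⟩

theorem isOpenEmbedding_tc_Ioo {a b : ℝ} (h : b ≤ a + 1) :
    Topology.IsOpenEmbedding fun x : Ioo a b => tc x := by
  refine .of_continuous_injective_isOpenMap ?_ ?_ ?_
  · exact (AddCircle.continuous_mk' 1).comp continuous_subtype_val
  · intro x y hxy
    exact Subtype.ext <| (AddCircle.coe_eq_coe_iff_of_mem_Ico (a := a) (p := (1 : ℝ))
      ⟨x.2.1.le, x.2.2.trans_le h⟩ ⟨y.2.1.le, y.2.2.trans_le h⟩).1 hxy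
  · exact QuotientAddGroup.isOpenMap_coe.comp isOpen_Ioo.isOpenMap_subtype_val

/-- An open arc of length at most `1` is homeomorphic to the interval of its lifts. -/
def iooHomeomorphOArc {a b : ℝ} (h : b ≤ a + 1) : Ioo a b ≃ₜ oArc a b :=
  (isOpenEmbedding_tc_Ioo h).isEmbedding.toHomeomorph.trans
    (.setCongr (by rw [oArc, image_eq_range]))

theorem coe_iooHomeomorphOArc {a b : ℝ} (h : b ≤ a + 1) (x : Ioo a b) :
    (iooHomeomorphOArc h x : 𝕊) = tc x := rfl

theorem iterate_sigmaC_tc (d n : ℕ) (x : ℝ) : (sigmaC d)^[n] (tc x) = tc (d ^ n * x) := by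
  induction n with
  | zero => simp
  | succ n ih =>
    rw [Function.iterate_succ_apply', ih, sigmaC, tc, tc, ← AddCircle.coe_nsmul, nsmul_eq_mul,
      pow_succ', mul_assoc]

theorem tc_add_intCast (x : ℝ) (n : ℤ) : tc (x + n) = tc x := by
  simp [tc]

/-- For any two dyadic intervals `[s,t]` and `[s',t']` in `ℝ/ℤ` there are integers
`n, m ≥ 0` and a homeomorphism `g` from the open arc `(s,t)` onto the open arc `(s',t')`
such that `σ₂^n ∘ g = σ₂^m` on `(s,t)`. -/
theorem dyadicInterval_canonical_map (a b a' b' : ℝ)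
    (h : IsDyadicInterval a b) (h' : IsDyadicInterval a' b') :
    ∃ (n m : ℕ) (g : ↥(oArc a b) ≃ₜ ↥(oArc a' b')),
      ∀ x : ↥(oArc a b), (sigmaC 2)^[n] (g x : 𝕊) = (sigmaC 2)^[m] ↑x := by
  obtain ⟨k, p, ha, hb⟩ := h.exists_consecutive
  obtain ⟨l, q, ha', hb'⟩ := h'.exists_consecutive
  have hk : (0 : ℝ) < 2 ^ k := by positivity
  have hl : (0 : ℝ) < 2 ^ l := by positivity
  let e : ℝ ≃ₜ ℝ := affineHomeomorph ((2 : ℝ) ^ k / 2 ^ l) ((q - p) / 2 ^ l) (by positivity)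
  have he (x : ℝ) : 2 ^ l * e x = 2 ^ k * x + (q - p : ℤ) := by
    simp only [e, affineHomeomorph_apply]
    push_cast
    field_simp
  have hmem (x : ℝ) : x ∈ Ioo a b ↔ e x ∈ Ioo a' b' := by
    have := he x
    push_cast at this
    rw [mem_Ioo, mem_Ioo, ha, hb, ha', hb', div_lt_iff₀' hk, lt_div_iff₀' hk, div_lt_iff₀' hl,
      lt_div_iff₀' hl, this]
    constructor <;> rintro ⟨h₁, h₂⟩ <;> constructor <;> linarith
  refine ⟨l, k, (iooHomeomorphOArc h.le).symm.trans
    ((e.subtype hmem).trans (iooHomeomorphOArc h'.le)), fun x => ?_⟩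
  obtain ⟨y, rfl⟩ := (iooHomeomorphOArc h.le).surjective x
  simp only [Homeomorph.trans_apply, Homeomorph.symm_apply_apply, coe_iooHomeomorphOArc,
    iterate_sigmaC_tc, Nat.cast_ofNat]
  exact (congrArg tc (he y)).trans (tc_add_intCast _ _)
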